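/- arXiv:2506.02988 — 2 statements merged into one kernel-verified Lean document; each statement's English description precedes it below -/
import Mathlib

section
/- Let φ : ℝ → ℝ be Lipschitz and 1-periodic with essential infimum of deriv φ (with respect to Lebesgue measure) equal to −1, let q ≥ 1 be an integer, and let ε > 0. Then there exist an integer N > 3q, a measurable partition X_1, …, X_N of [0,1) with Lebesgue measure λ(X_i) > 0 for every i, and weights ŵ = (ŵ_1, …, ŵ_N) ∈ ℝ^N with ŵ_1 = −1, ŵ_i ≥ −1 for all i, and ∑_{i=1}^N ŵ_i·λ(X_i) = 0, such that the function ψ(x) = φ(0) + ∫_0^x W dλ, where W : ℝ → ℝ is the 1-periodic extension of ∑_{i=1}^N ŵ_i·1_{X_i}, is Lipschitz and 1-periodic, has essential infimum of deriv ψ equal to −1, and satisfies sup_x |φ(x) − ψ(x)| + K(φ − ψ) < ε. -/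
open MeasureTheory

/-- The least Lipschitz constant of `h : ℝ → ℝ`. -/
noncomputable def lipConst (h : ℝ → ℝ) : ℝ :=
  sInf {K : ℝ | 0 ≤ K ∧ ∀ x y : ℝ, |h x - h y| ≤ K * |x - y|}

open Set

/-- A property holding almost everywhere on `[0,1)` holds almost everywhere on `ℝ` after reduction
modulo `1`. -/
theorem ae_fract_of_ae_Ico {P : ℝ → Prop} (h : ∀ᵐ t : ℝ, t ∈ Ico (0 : ℝ) 1 → P t) :
    ∀ᵐ t : ℝ, P (Int.fract t) := by
  have key : ∀ᵐ t : ℝ, ∀ n : ℤ, t - n ∈ Ico (0 : ℝ) 1 → P (t - n) := by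
    rw [ae_all_iff]
    intro n
    exact (measurePreserving_sub_right volume (n : ℝ)).quasiMeasurePreserving.ae h
  filter_upwards [key] with t ht
  exact ht ⌊t⌋ ⟨Int.fract_nonneg t, Int.fract_lt_one t⟩

/-- A measurable function with finitely many values on `[0,1)`, bounded below by `-1` and equal to
`-1` on a set of positive measure, is almost everywhere on `[0,1)` a simple function over a
partition into more than `M` sets of positive measure. -/
theorem exists_partition_of_finite_image (M : ℕ) {f : ℝ → ℝ} (hf : Measurable f)
    (hfin : (f '' Ico (0 : ℝ) 1).Finite) (hge : ∀ t, -1 ≤ f t)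
    (hpos : 0 < volume (Ico (0 : ℝ) 1 ∩ f ⁻¹' {-1})) :
    ∃ N : ℕ, ∃ hN : M < N, ∃ X : Fin N → Set ℝ,
      (∀ i, MeasurableSet (X i)) ∧ Pairwise (Function.onFun Disjoint X) ∧
      (⋃ i, X i) = Ico (0 : ℝ) 1 ∧ (∀ i, 0 < volume (X i)) ∧
      ∃ w : Fin N → ℝ, w ⟨0, by omega⟩ = -1 ∧ (∀ i, -1 ≤ w i) ∧
        ∀ᵐ t : ℝ, t ∈ Ico (0 : ℝ) 1 →
          ∑ i, w i * indicator (X i) (fun _ => (1 : ℝ)) t = f t := by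
  classical
  set F : ℝ → ℝ × ℕ := fun t => (f t, ⌊((M : ℝ) + 1) * t⌋₊) with hF
  have hFm : Measurable F := hf.prodMk (Nat.measurable_floor.comp (measurable_id.const_mul _))
  have hT : (F '' Ico (0 : ℝ) 1).Finite := by
    refine (hfin.prod (finite_Iic (M + 1))).subset ?_
    rintro _ ⟨t, ht, rfl⟩
    refine ⟨mem_image_of_mem f ht, ?_⟩
    simp only [hF, mem_Iic]
    refine Nat.floor_le_of_le ?_
    push_cast
    nlinarith [ht.1, ht.2, (Nat.cast_nonneg M : (0 : ℝ) ≤ M)]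
  have hSfin : {l ∈ F '' Ico (0 : ℝ) 1 | 0 < volume (Ico (0 : ℝ) 1 ∩ F ⁻¹' {l})}.Finite :=
    hT.subset (sep_subset _ _)
  set S : Finset (ℝ × ℕ) := hSfin.toFinset with hS
  have hSmem : ∀ l, l ∈ S ↔ l ∈ F '' Ico (0 : ℝ) 1 ∧ 0 < volume (Ico (0 : ℝ) 1 ∩ F ⁻¹' {l}) := by
    intro l; simp [hS]
  have hae : ∀ᵐ t : ℝ, t ∈ Ico (0 : ℝ) 1 → F t ∈ S := by
    have : ∀ᵐ t : ℝ, ∀ l ∈ F '' Ico (0 : ℝ) 1, l ∉ S → ¬ (t ∈ Ico (0 : ℝ) 1 ∧ F t = l) := by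
      rw [ae_ball_iff hT.countable]
      intro l hl
      by_cases hlS : l ∈ S
      · simp [hlS]
      · have h0 : volume (Ico (0 : ℝ) 1 ∩ F ⁻¹' {l}) = 0 := by
          by_contra h
          exact hlS ((hSmem l).2 ⟨hl, pos_iff_ne_zero.2 h⟩)
        filter_upwards [measure_eq_zero_iff_ae_notMem.1 h0] with t ht _ h
        exact ht h
    filter_upwards [this] with t ht htI
    by_contra h
    exact ht _ (mem_image_of_mem F htI) h ⟨htI, rfl⟩
  have hmeet : ∀ E ⊆ Ico (0 : ℝ) 1, 0 < volume E → ∃ t ∈ E, F t ∈ S := by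
    intro E hE hE0
    by_contra! h
    refine hE0.ne' (measure_eq_zero_iff_ae_notMem.2 ?_)
    filter_upwards [hae] with t ht htE
    exact h t htE (ht (hE htE))
  obtain ⟨t₀, ht₀, hs₀⟩ := hmeet _ inter_subset_left hpos
  have hcard : M + 1 ≤ S.card := by
    have hsub : Finset.range (M + 1) ⊆ S.image Prod.snd := by
      intro j hj
      have hj' : (j : ℝ) + 1 ≤ M + 1 := by exact_mod_cast Finset.mem_range.1 hj
      have hM : (0 : ℝ) < M + 1 := by positivity
      obtain ⟨t, ht, htS⟩ := hmeet (Ico (j / (M + 1) : ℝ) ((j + 1) / (M + 1)))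
        (Ico_subset_Ico (by positivity) ((div_le_one hM).2 hj'))
        (by
          rw [Real.volume_Ico, ENNReal.ofReal_pos, ← sub_div]
          simp only [add_sub_cancel_left]
          positivity)
      refine Finset.mem_image.2 ⟨F t, htS, ?_⟩
      have h1 := (div_le_iff₀ hM).1 ht.1
      have h2 := (lt_div_iff₀ hM).1 ht.2
      refine (Nat.floor_eq_iff ?_).2 ⟨?_, ?_⟩
      · nlinarith [(Nat.cast_nonneg j : (0 : ℝ) ≤ j)]
      · linarith
      · linarith
    calc M + 1 = (Finset.range (M + 1)).card := (Finset.card_range _).symm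
      _ ≤ _ := Finset.card_le_card hsub
      _ ≤ _ := Finset.card_image_le
  have hN : 0 < S.card := by omega
  set s₀ : S := ⟨F t₀, hs₀⟩
  set e : Fin S.card ≃ S := (Equiv.swap ⟨0, hN⟩ (S.equivFin s₀)).trans S.equivFin.symm with he
  have he0 : e ⟨0, hN⟩ = s₀ := by simp [he]
  set r : ℝ × ℕ → ℝ × ℕ := fun l => if l ∈ S then l else s₀ with hr
  have hrm : Measurable r :=
    Measurable.ite S.measurableSet measurable_id measurable_const
  have hrS : ∀ l, r l ∈ S := by
    intro l
    by_cases h : l ∈ S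
    · simp [hr, h]
    · simp [hr, h]
  have hrid : ∀ l ∈ S, r l = l := fun l h => by simp [hr, h]
  set X : Fin S.card → Set ℝ := fun i => Ico (0 : ℝ) 1 ∩ {t | r (F t) = e i} with hX
  refine ⟨S.card, hcard, X, ?_, ?_, ?_, ?_, fun i => (e i : ℝ × ℕ).1, ?_, ?_, ?_⟩
  · exact fun i => measurableSet_Ico.inter ((hrm.comp hFm) (measurableSet_singleton _))
  · intro i j hij
    refine Set.disjoint_left.2 ?_
    rintro t ⟨-, h1⟩ ⟨-, h2⟩
    exact hij (e.injective (Subtype.ext (h1.symm.trans h2)))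
  · ext t
    simp only [hX, mem_iUnion]
    refine ⟨fun ⟨i, hi⟩ => hi.1, fun ht => ⟨e.symm ⟨r (F t), hrS _⟩, ht, ?_⟩⟩
    simp
  · intro i
    refine ((hSmem _).1 (e i).2).2.trans_le (measure_mono ?_)
    rintro t ⟨ht, h⟩
    refine ⟨ht, ?_⟩
    have h' : F t = e i := h
    change r (F t) = e i
    rw [h', hrid _ (e i).2]
  · have : (e ⟨0, hN⟩ : ℝ × ℕ).1 = f t₀ := by rw [he0]
    exact this.trans ht₀.2
  · intro i
    obtain ⟨t, -, ht⟩ := ((hSmem _).1 (e i).2).1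
    exact (hge t).trans_eq (congrArg Prod.fst ht)
  · filter_upwards [hae] with t ht htI
    have hs := ht htI
    rw [Finset.sum_eq_single (e.symm ⟨F t, hs⟩)]
    · have hmem : t ∈ X (e.symm ⟨F t, hs⟩) := ⟨htI, by
        change r (F t) = e (e.symm ⟨F t, hs⟩)
        rw [e.apply_symm_apply, hrid _ hs]⟩
      rw [indicator_of_mem hmem, mul_one, e.apply_symm_apply]
    · intro j _ hj
      rw [indicator_of_notMem, mul_zero]
      rintro ⟨-, h⟩
      apply hj
      rw [Equiv.eq_symm_apply]
      refine Subtype.ext ?_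
      have h' : r (F t) = e j := h
      rw [← h', hrid _ hs]
    · simp

/-- A bounded mean-zero function `g ≥ -1` is within `3δ` of a mean-zero function `f ≥ -1` with
finitely many values which equals `-1` on a prescribed set of measure at most `1/2` where
`g < -1 + δ`. -/
theorem exists_finite_range_approx (μ : Measure ℝ) [IsProbabilityMeasure μ] {g : ℝ → ℝ} {C δ : ℝ}
    (hg : Measurable g) (hC : ∀ t, |g t| ≤ C) (hge : ∀ᵐ t ∂μ, -1 ≤ g t) (hmean : ∫ t, g t ∂μ = 0)
    (hδ : 0 < δ) {A : Set ℝ} (hA : MeasurableSet A) (hAhalf : μ.real A ≤ 1 / 2)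
    (hAg : ∀ t ∈ A, g t < -1 + δ) :
    ∃ f : ℝ → ℝ, Measurable f ∧ (range f).Finite ∧ (∀ t, -1 ≤ f t) ∧ (∀ t ∈ A, f t = -1) ∧
      (∀ᵐ t ∂μ, |f t - g t| ≤ 3 * δ) ∧ ∫ t, f t ∂μ = 0 := by
  classical
  set u : ℝ → ℝ := fun t => δ * ⌊(g t + 1) / δ⌋₊ with hu
  have hum : Measurable u :=
    (measurable_from_top.comp (Nat.measurable_floor.comp
      ((hg.add_const 1).div_const δ))).const_mul δ
  have hu0 : ∀ t, 0 ≤ u t := fun t => by positivity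
  have hule : ∀ t, -1 ≤ g t → u t ≤ g t + 1 := by
    intro t ht
    have := Nat.floor_le (div_nonneg (by linarith : 0 ≤ g t + 1) hδ.le)
    rw [le_div_iff₀ hδ] at this
    simp only [hu]; linarith
  have hult : ∀ t, g t + 1 < u t + δ := by
    intro t
    have := Nat.lt_floor_add_one ((g t + 1) / δ)
    rw [div_lt_iff₀ hδ] at this
    simp only [hu]; linarith
  have hufin : (range u).Finite := by
    refine ((finite_Iic ⌊(C + 1) / δ⌋₊).image (fun n : ℕ => δ * (n : ℝ))).subset ?_
    rintro _ ⟨t, rfl⟩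
    refine ⟨_, ?_, rfl⟩
    refine Nat.floor_mono ?_
    gcongr
    exact (le_abs_self _).trans (hC t)
  set h₀ : ℝ → ℝ := fun t => if t ∈ A then -1 else -1 + u t with hh₀
  have hh₀m : Measurable h₀ := Measurable.ite hA measurable_const (hum.const_add _)
  have hgi : Integrable g μ :=
    Integrable.of_bound hg.aestronglyMeasurable C (Filter.Eventually.of_forall hC)
  have hupper : ∀ᵐ t ∂μ, h₀ t ≤ g t := by
    filter_upwards [hge] with t ht
    by_cases h : t ∈ A
    · simpa [hh₀, h] using ht
    · simp only [hh₀, h, if_false]; linarith [hule t ht]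
  have hlower : ∀ t, g t - δ ≤ h₀ t := by
    intro t
    by_cases h : t ∈ A
    · simp only [hh₀, h, if_true]; linarith [hAg t h]
    · simp only [hh₀, h, if_false]; linarith [hult t]
  have hh₀i : Integrable h₀ μ := by
    refine Integrable.of_bound hh₀m.aestronglyMeasurable (C + δ) ?_
    filter_upwards [hupper] with t ht
    rw [Real.norm_eq_abs, abs_le]
    have := abs_le.1 (hC t)
    constructor <;> linarith [hlower t]
  have hI1 : ∫ t, h₀ t ∂μ ≤ 0 := hmean ▸ integral_mono_ae hh₀i hgi hupper
  have hI2 : -δ ≤ ∫ t, h₀ t ∂μ := by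
    have := integral_mono (hgi.sub (integrable_const δ)) hh₀i hlower
    simp only [Pi.sub_apply] at this
    rw [integral_sub hgi (integrable_const δ), hmean] at this
    simpa using this
  have hB : 1 / 2 ≤ μ.real Aᶜ := by
    rw [probReal_compl_eq_one_sub hA]; linarith
  set c : ℝ := -(∫ t, h₀ t ∂μ) / μ.real Aᶜ with hc
  have hBpos : 0 < μ.real Aᶜ := by linarith
  have hc0 : 0 ≤ c := div_nonneg (by linarith) hBpos.le
  have hc2 : c ≤ 2 * δ := by
    rw [hc, div_le_iff₀ hBpos]; nlinarith
  have hind : ∀ t, Aᶜ.indicator (fun _ => c) t = if t ∈ A then 0 else c := by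
    intro t; by_cases h : t ∈ A <;> simp [h]
  refine ⟨fun t => h₀ t + Aᶜ.indicator (fun _ => c) t,
    hh₀m.add (measurable_const.indicator hA.compl), ?_, ?_, ?_, ?_, ?_⟩
  · refine ((hufin.image (fun y => -1 + y + c)).insert (-1)).subset ?_
    rintro _ ⟨t, rfl⟩
    by_cases h : t ∈ A
    · left; simp [hh₀, h]
    · right; exact ⟨u t, mem_range_self t, by simp [hh₀, h]⟩
  · intro t
    by_cases h : t ∈ A
    · simp [hh₀, h]
    · simp only [hh₀, hind, h, if_false]; linarith [hu0 t]
  · intro t h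
    simp [hh₀, h]
  · filter_upwards [hupper] with t ht
    have h1 : 0 ≤ Aᶜ.indicator (fun _ => c) t := indicator_nonneg (fun _ _ => hc0) t
    have h2 : Aᶜ.indicator (fun _ => c) t ≤ c := indicator_le_self' (fun _ _ => hc0) t
    rw [abs_le]
    constructor <;> linarith [hlower t]
  · rw [integral_add hh₀i ((integrable_const c).indicator hA.compl),
      integral_indicator_const c hA.compl, smul_eq_mul, hc]
    field_simp
    ring

/-- The real essential infimum of a function bounded below almost everywhere is a lower bound. -/
theorem ae_essInf_le_of_forall_ge {f : ℝ → ℝ} {C : ℝ} (h : ∀ t, C ≤ f t) :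
    ∀ᵐ t : ℝ, essInf f volume ≤ f t :=
  ae_essInf_le (Filter.isBoundedUnder_of ⟨C, h⟩)

/-- If `f ≤ C` everywhere, an almost everywhere lower bound is at most the essential infimum. -/
theorem le_essInf_of_forall_le {f : ℝ → ℝ} {a C : ℝ} (hC : ∀ t, f t ≤ C)
    (h : ∀ᵐ t : ℝ, a ≤ f t) : a ≤ essInf f volume :=
  le_essInf_of_ae_le a h (Filter.IsBoundedUnder.isCoboundedUnder_ge
    (Filter.isBoundedUnder_of ⟨C, hC⟩))

/-- A function bounded below by `a`, equal to `a` on a set of positive measure, has essential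
infimum `a`. -/
theorem essInf_eq_of_forall_ge {f : ℝ → ℝ} {a C : ℝ} (hC : ∀ t, f t ≤ C) (h : ∀ t, a ≤ f t)
    {E : Set ℝ} (hE : 0 < volume E) (hEa : ∀ t ∈ E, f t = a) : essInf f volume = a := by
  refine le_antisymm ?_ (le_essInf_of_forall_le hC (Filter.Eventually.of_forall h))
  by_contra! hlt
  refine hE.ne' (measure_eq_zero_iff_ae_notMem.2 ?_)
  filter_upwards [ae_essInf_le_of_forall_ge h] with t ht htE
  rw [hEa t htE] at ht
  linarith

/-- A primitive of a measurable function bounded almost everywhere by `C` has increments bounded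
by `C`. -/
theorem abs_intervalIntegral_sub_le {W : ℝ → ℝ} {C : ℝ}
    (hi : ∀ a b, IntervalIntegrable W volume a b)
    (hC : ∀ᵐ t : ℝ, |W t| ≤ C) (x y : ℝ) :
    |(∫ t in (0 : ℝ)..x, W t) - ∫ t in (0 : ℝ)..y, W t| ≤ C * |x - y| := by
  rw [intervalIntegral.integral_interval_sub_left (hi _ _) (hi _ _)]
  have := intervalIntegral.norm_integral_le_of_norm_le_const_ae (a := y) (b := x) (f := W) (C := C)
    (by filter_upwards [hC] with t ht _ using ht)
  simpa using this

/-- Discretization lemma: a standard-like Lipschitz forcing `φ` can be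
approximated in the Lipschitz norm by a standard-like forcing `ψ` whose
derivative is the 1-periodic extension of a simple function `∑ ŵ_i 1_{X_i}`
over a finite measurable partition of `[0,1)` into sets of positive measure,
with `N > 3q` pieces, `ŵ_1 = -1`, all `ŵ_i ≥ -1` and `∑ ŵ_i λ(X_i) = 0`. -/
theorem stmt9 (φ : ℝ → ℝ) (hL : ∃ K, LipschitzWith K φ)
    (hper : ∀ x, φ (x + 1) = φ x)
    (hinf : essInf (deriv φ) volume = -1)
    (q : ℕ) (hq : 1 ≤ q) (ε : ℝ) (hε : 0 < ε) :
    ∃ N : ℕ, ∃ hN : 3 * q < N, ∃ X : Fin N → Set ℝ,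
      (∀ i, MeasurableSet (X i)) ∧ Pairwise (Function.onFun Disjoint X) ∧
      (⋃ i, X i) = Set.Ico (0 : ℝ) 1 ∧ (∀ i, 0 < volume (X i)) ∧
      ∃ w : Fin N → ℝ, w ⟨0, by omega⟩ = -1 ∧ (∀ i, -1 ≤ w i) ∧
        (∑ i, w i * (volume (X i)).toReal = 0) ∧
        (let W : ℝ → ℝ := fun t =>
            ∑ i, w i * Set.indicator (X i) (fun _ => (1 : ℝ)) (Int.fract t)
         let ψ : ℝ → ℝ := fun x => φ 0 + ∫ t in (0 : ℝ)..x, W t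
         (∃ K, LipschitzWith K ψ) ∧ (∀ x, ψ (x + 1) = ψ x) ∧
           essInf (deriv ψ) volume = -1 ∧
           (⨆ x : ℝ, |φ x - ψ x|) + lipConst (fun x => φ x - ψ x) < ε) := by
  classical
  obtain ⟨K, hK⟩ := hL
  set g : ℝ → ℝ := deriv φ with hgdef
  have hgm : Measurable g := measurable_deriv φ
  have hgK : ∀ t, |g t| ≤ K := fun t => norm_deriv_le_of_lipschitz hK
  have hgper : ∀ t, g (t + 1) = g t := by
    intro t
    rw [hgdef, ← deriv_comp_add_const]
    congr 1
    exact funext hper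
  have hgfract : ∀ t, g (Int.fract t) = g t := fun t => by
    rw [Int.fract]
    simpa using (show Function.Periodic g 1 from hgper).sub_int_mul_eq (x := t) ⌊t⌋
  have hgi : ∀ a b, IntervalIntegrable g volume a b := fun a b =>
    (hK.lipschitzOnWith.absolutelyContinuousOnInterval).intervalIntegrable_deriv
  have hφ : ∀ x, φ x - φ 0 = ∫ t in (0 : ℝ)..x, g t := fun x =>
    (hK.lipschitzOnWith.absolutelyContinuousOnInterval).integral_deriv_eq_sub.symm
  have hg1 : ∀ᵐ t : ℝ, -1 ≤ g t := hinf ▸ ae_essInf_le_of_forall_ge fun t => (abs_le.1 (hgK t)).1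
  set δ := ε / 7 with hδdef
  have hδ : 0 < δ := by positivity
  have hApos : 0 < volume (Ico (0 : ℝ) 1 ∩ {t | g t < -1 + δ}) := by
    rw [pos_iff_ne_zero]
    intro h0
    have h1 : ∀ᵐ t : ℝ, t ∈ Ico (0 : ℝ) 1 → -1 + δ ≤ g t := by
      filter_upwards [measure_eq_zero_iff_ae_notMem.1 h0] with t ht htI
      by_contra! h
      exact ht ⟨htI, h⟩
    have h2 : ∀ᵐ t : ℝ, -1 + δ ≤ g t := by
      filter_upwards [ae_fract_of_ae_Ico h1] with t ht
      rwa [hgfract] at ht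
    have := le_essInf_of_forall_le (fun t => (abs_le.1 (hgK t)).2) h2
    linarith
  obtain ⟨A, hA, hAI, hAg, hApos, hAhalf⟩ : ∃ A : Set ℝ, MeasurableSet A ∧ A ⊆ Ico 0 1 ∧
      (∀ t ∈ A, g t < -1 + δ) ∧ 0 < volume A ∧ volume.real A ≤ 1 / 2 := by
    have hm : MeasurableSet {t | g t < -1 + δ} := measurableSet_lt hgm measurable_const
    have half : ∀ a b : ℝ, 0 ≤ a → b ≤ 1 → b - a = 1 / 2 →
        0 < volume (Ico a b ∩ {t | g t < -1 + δ}) → ∃ A : Set ℝ, MeasurableSet A ∧ A ⊆ Ico 0 1 ∧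
      (∀ t ∈ A, g t < -1 + δ) ∧ 0 < volume A ∧ volume.real A ≤ 1 / 2 := by
      intro a b ha hb hab hpos
      refine ⟨_, measurableSet_Ico.inter hm, inter_subset_left.trans (Ico_subset_Ico ha hb),
        fun t ht => ht.2, hpos, ?_⟩
      refine (measureReal_mono inter_subset_left (by simp)).trans ?_
      rw [Real.volume_real_Ico_of_le (by linarith), hab]
    rw [← Ico_union_Ico_eq_Ico (show (0 : ℝ) ≤ 1 / 2 by norm_num) (by norm_num),
      union_inter_distrib_right] at hApos
    by_cases h : 0 < volume (Ico (0 : ℝ) (1 / 2) ∩ {t | g t < -1 + δ})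
    · exact half _ _ le_rfl (by norm_num) (by norm_num) h
    · refine half (1 / 2) 1 (by norm_num) le_rfl (by norm_num) ?_
      refine hApos.trans_le ((measure_union_le _ _).trans ?_)
      rw [nonpos_iff_eq_zero.1 (not_lt.1 h), zero_add]
  have : IsProbabilityMeasure (volume.restrict (Ico (0 : ℝ) 1)) := ⟨by simp⟩
  have hIco : ∀ F : ℝ → ℝ, ∫ t in Ico (0 : ℝ) 1, F t = ∫ t in (0 : ℝ)..1, F t := fun F => by
    rw [intervalIntegral.integral_of_le zero_le_one, integral_Ico_eq_integral_Ioc]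
  obtain ⟨f, hfm, hffin, hfge, hfA, hfg, hfint⟩ :=
    exists_finite_range_approx (volume.restrict (Ico (0 : ℝ) 1)) hgm hgK (ae_restrict_of_ae hg1)
      (by rw [hIco, ← hφ]; simpa using sub_eq_zero.2 (hper 0)) hδ hA
      (by rw [measureReal_restrict_apply hA, inter_eq_left.2 hAI]; exact hAhalf) hAg
  obtain ⟨N, hN, X, hXm, hXd, hXu, hXpos, w, hw0, hw1, hwf⟩ :=
    exists_partition_of_finite_image (3 * q) hfm (hffin.subset (image_subset_range _ _)) hfge
      (hApos.trans_le (measure_mono fun t ht => ⟨hAI ht, hfA t ht⟩))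
  have hXI : ∀ i, X i ⊆ Ico 0 1 := fun i => hXu ▸ subset_iUnion X i
  refine ⟨N, hN, X, hXm, hXd, hXu, hXpos, w, hw0, hw1, ?_, ?_⟩
  · rw [← hfint, ← setIntegral_congr_ae measurableSet_Ico hwf, integral_finsetSum]
    · refine Finset.sum_congr rfl fun i _ => ?_
      rw [integral_const_mul, integral_indicator_const _ (hXm i),
        measureReal_restrict_apply (hXm i), inter_eq_left.2 (hXI i)]
      simp [measureReal_def]
    · exact fun i _ => ((integrable_const _).indicator (hXm i)).const_mul _
  intro W ψ
  have hWval : ∀ (i : Fin N) (t : ℝ), Int.fract t ∈ X i → W t = w i := by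
    intro i t ht
    simp only [W]
    rw [Finset.sum_eq_single i]
    · simp [ht]
    · intro j _ hj
      rw [indicator_of_notMem (fun h => Set.disjoint_left.1 (hXd hj) h ht), mul_zero]
    · simp
  have hWex : ∀ t, ∃ i, W t = w i := by
    intro t
    have : Int.fract t ∈ ⋃ i, X i := hXu ▸ ⟨Int.fract_nonneg t, Int.fract_lt_one t⟩
    obtain ⟨i, hi⟩ := mem_iUnion.1 this
    exact ⟨i, hWval i t hi⟩
  have hWm : Measurable W := by
    refine Finset.measurable_sum _ fun i _ => ?_
    exact ((measurable_const.indicator (hXm i)).comp measurable_fract).const_mul _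
  set C : ℝ := ∑ i, |w i| with hCdef
  have hC0 : 0 ≤ C := Finset.sum_nonneg fun i _ => abs_nonneg _
  have hWC : ∀ t, |W t| ≤ C := by
    intro t
    obtain ⟨i, hi⟩ := hWex t
    rw [hi]
    exact Finset.single_le_sum (f := fun i => |w i|) (fun i _ => abs_nonneg _) (Finset.mem_univ i)
  have hWge : ∀ t, -1 ≤ W t := fun t => by
    obtain ⟨i, hi⟩ := hWex t
    rw [hi]; exact hw1 i
  have hWper : Function.Periodic W 1 := fun t => by simp only [W, Int.fract_add_one]
  have hWli : LocallyIntegrable W volume :=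
    (locallyIntegrable_const C).mono hWm.aestronglyMeasurable
      (Filter.Eventually.of_forall fun t => (hWC t).trans (le_abs_self C))
  have hWi : ∀ a b, IntervalIntegrable W volume a b := fun a b =>
    (intervalIntegrable_const (c := C)).mono_fun' hWm.aestronglyMeasurable
      (Filter.Eventually.of_forall hWC)
  have hWf : ∀ᵐ t : ℝ, t ∈ Ico (0 : ℝ) 1 → W t = f t := by
    filter_upwards [hwf] with t ht htI
    simp only [W, Int.fract_eq_self.2 htI]
    exact ht htI
  have hWint : ∫ t in (0 : ℝ)..1, W t = 0 := by
    rw [← hIco, setIntegral_congr_ae measurableSet_Ico hWf, hfint]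
  have hψper : ∀ x, ψ (x + 1) = ψ x := by
    intro x
    have h1 := intervalIntegral.integral_add_adjacent_intervals (hWi 0 x) (hWi x (x + 1))
    have h2 := hWper.intervalIntegral_add_eq x 0
    rw [zero_add, hWint] at h2
    simp only [ψ]
    linarith
  have hψlip : ∀ x y, |ψ x - ψ y| ≤ C * |x - y| := by
    intro x y
    simp only [ψ, add_sub_add_left_eq_sub]
    exact abs_intervalIntegral_sub_le hWi (Filter.Eventually.of_forall hWC) x y
  have hψderiv : deriv ψ =ᵐ[volume] W := by
    filter_upwards [LocallyIntegrable.ae_hasDerivAt_integral hWli] with x hx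
    exact ((hx 0).const_add (φ 0)).deriv
  have hdiff : ∀ᵐ t : ℝ, |g t - W t| ≤ 3 * δ := by
    have h1 : ∀ᵐ t : ℝ, t ∈ Ico (0 : ℝ) 1 → |g t - W t| ≤ 3 * δ := by
      filter_upwards [(ae_restrict_iff' measurableSet_Ico).1 hfg, hWf] with t h1 h2 htI
      rw [h2 htI, abs_sub_comm]
      exact h1 htI
    filter_upwards [ae_fract_of_ae_Ico h1] with t ht
    rw [hgfract] at ht
    simpa only [W, Int.fract_fract] using ht
  have hD : ∀ x, φ x - ψ x = ∫ t in (0 : ℝ)..x, (g t - W t) := by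
    intro x
    rw [intervalIntegral.integral_sub (hgi _ _) (hWi _ _), ← hφ]
    simp only [ψ]
    ring
  have hDlip : ∀ x y, |(φ x - ψ x) - (φ y - ψ y)| ≤ 3 * δ * |x - y| := by
    intro x y
    rw [hD, hD]
    exact abs_intervalIntegral_sub_le (fun a b => (hgi a b).sub (hWi a b)) hdiff x y
  have hDper : Function.Periodic (fun x => φ x - ψ x) 1 := fun x => by
    simp only [hper, hψper]
  have hDsup : ∀ x, |φ x - ψ x| ≤ 3 * δ := by
    intro x
    have h1 : φ (Int.fract x) - ψ (Int.fract x) = φ x - ψ x := by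
      rw [Int.fract]
      simpa using hDper.sub_int_mul_eq (x := x) ⌊x⌋
    have h0 : φ 0 - ψ 0 = 0 := by simp [ψ]
    have h2 := hDlip (Int.fract x) 0
    rw [h1, h0, sub_zero, sub_zero, abs_of_nonneg (Int.fract_nonneg x)] at h2
    nlinarith [Int.fract_lt_one x]
  refine ⟨⟨C.toNNReal, LipschitzWith.of_dist_le_mul fun x y => ?_⟩, hψper, ?_, ?_⟩
  · rw [Real.coe_toNNReal C hC0]
    exact hψlip x y
  · rw [essInf_congr_ae hψderiv]
    refine essInf_eq_of_forall_ge (fun t => (le_abs_self _).trans (hWC t)) hWge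
      (hXpos ⟨0, by omega⟩) fun t ht => ?_
    rw [← hw0]
    refine hWval _ t ?_
    rwa [Int.fract_eq_self.2 (hXI _ ht)]
  · have h1 : ⨆ x : ℝ, |φ x - ψ x| ≤ 3 * δ := ciSup_le hDsup
    have h2 : lipConst (fun x => φ x - ψ x) ≤ 3 * δ :=
      csInf_le ⟨0, fun _ h => h.1⟩ ⟨by positivity, hDlip⟩
    linarith
end

section
/- Let q ≥ 1 and N > 3q be integers, let X_1, …, X_N be a measurable partition of [0,1) with Lebesgue measure λ(X_i) > 0 for each i, let w ∈ ℝ^N satisfy ∑_{i=1}^N w_i·λ(X_i) = 0, let c ∈ ℝ, and let ψ(x) = c + ∫_0^x W dλ, where W : ℝ → ℝ is the 1-periodic extension of ∑_{i=1}^N w_i·1_{X_i} (so ψ is Lipschitz and 1-periodic). Suppose b ∈ (0,1], ω ∈ ℝ, and p ∈ ℤ are such that the q-th iterate of f(x) = x + ω + b·ψ(x) equals x ↦ x + p. Then there exist three pairwise distinct multisets J_1, J_2, J_3, each of cardinality q with elements in {1,…,N}, such that ∏_{j ∈ J_i} (1 + b·w_j) = 1 (product taken with multiplicity) for i = 1,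 2, 3. -/
open MeasureTheory

/-- A real function with a Lipschitz left inverse pulls null sets back to null sets. -/
theorem tendsto_ae_of_lipschitzWith_leftInverse {K : NNReal} {f g : ℝ → ℝ}
    (hg : LipschitzWith K g) (hgf : Function.LeftInverse g f) :
    Filter.Tendsto f (ae volume) (ae volume) := by
  intro s hs
  rw [Filter.mem_map, mem_ae_iff] at *
  have hsub : (f ⁻¹' s)ᶜ ⊆ g '' sᶜ := fun x hx => ⟨f x, hx, hgf x⟩
  refine measure_mono_null hsub ?_
  have himage := hg.hausdorffMeasure_image_le zero_le_one sᶜ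
  rw [hausdorffMeasure_real, hs, mul_zero] at himage
  exact le_antisymm himage bot_le

/-- The chain rule for iterates along an orbit of points of differentiability. -/
theorem hasDerivAt_iterate_orbit {f f' : ℝ → ℝ} {x : ℝ} (n : ℕ)
    (h : ∀ k < n, HasDerivAt f (f' (f^[k] x)) (f^[k] x)) :
    HasDerivAt f^[n] (∏ k ∈ Finset.range n, f' (f^[k] x)) x := by
  induction n with
  | zero => simpa using! hasDerivAt_id x
  | succ n ih =>
    rw [Function.iterate_succ', Finset.prod_range_succ, mul_comm]
    exact (h n n.lt_succ_self).comp x (ih fun k hk => h k (hk.trans n.lt_succ_self))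

/-- If a Lipschitz function has a translation as its `q`-th iterate, then its derivatives along
almost every orbit segment of length `q` multiply to `1`. -/
theorem ae_prod_deriv_orbit_eq_one {K : NNReal} {f f' : ℝ → ℝ} {q : ℕ} {p : ℝ}
    (hf : LipschitzWith K f) (hderiv : ∀ᵐ x, HasDerivAt f (f' x) x)
    (hiter : f^[q] = fun x => x + p) :
    ∀ᵐ x, ∏ k ∈ Finset.range q, f' (f^[k] x) = 1 := by
  have horbit : ∀ᵐ x, ∀ k ∈ Finset.range q, HasDerivAt f (f' (f^[k] x)) (f^[k] x) := by
    refine (Filter.eventually_all_finset _).2 fun k hk => ?_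
    have hinv : Function.LeftInverse (fun y => f^[q - k] y - p) f^[k] := by
      intro x
      change f^[q - k] (f^[k] x) - p = x
      rw [← Function.iterate_add_apply, Nat.sub_add_cancel (Finset.mem_range.1 hk).le, hiter]
      exact add_sub_cancel_right x p
    have hlip : LipschitzWith (K ^ (q - k)) fun y => f^[q - k] y - p := by
      intro x y
      simpa using! hf.iterate (q - k) x y
    exact (tendsto_ae_of_lipschitzWith_leftInverse hlip hinv).eventually hderiv
  filter_upwards [horbit] with x hx
  have hprod := hasDerivAt_iterate_orbit q fun k hk => hx k (Finset.mem_range.2 hk)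
  rw [hiter] at hprod
  exact hprod.unique ((hasDerivAt_id x).add_const p)

/-- A primitive of a bounded measurable function is Lipschitz. -/
theorem lipschitzWith_primitive {g : ℝ → ℝ} {C : NNReal} (a : ℝ)
    (hg : LocallyIntegrable g) (hC : ∀ t, ‖g t‖ ≤ C) :
    LipschitzWith C fun x => ∫ t in a..x, g t := by
  have hint (x y : ℝ) : IntervalIntegrable g volume x y :=
    intervalIntegrable_iff.mpr
      ((hg.integrableOn_isCompact isCompact_uIcc).mono_set Set.uIoc_subset_uIcc)
  refine LipschitzWith.of_dist_le_mul fun x y => ?_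
  rw [dist_eq_norm, intervalIntegral.integral_interval_sub_left (hint a x) (hint a y),
    Real.dist_eq]
  exact intervalIntegral.norm_integral_le_of_norm_le_const fun t _ => hC t

/-- Multisets of size `q` with a property that together meet every index include three distinct
ones as soon as there are more than `2 * q` indices. -/
theorem exists_three_distinct_multisets {α : Type*} [Fintype α] {q : ℕ}
    (hcard : 2 * q < Fintype.card α) {P : Multiset α → Prop}
    (h : ∀ i, ∃ J, i ∈ J ∧ Multiset.card J = q ∧ P J) :
    ∃ J₁ J₂ J₃ : Multiset α,
      Multiset.card J₁ = q ∧ Multiset.card J₂ = q ∧ Multiset.card J₃ = q ∧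
      J₁ ≠ J₂ ∧ J₁ ≠ J₃ ∧ J₂ ≠ J₃ ∧ P J₁ ∧ P J₂ ∧ P J₃ := by
  classical
  have hnotMem (J : Multiset α) (hJ : Multiset.card J < Fintype.card α) : ∃ i, i ∉ J := by
    by_contra! hall
    have huniv : J.toFinset = Finset.univ :=
      Finset.eq_univ_of_forall fun i => Multiset.mem_toFinset.2 (hall i)
    have hle := Multiset.toFinset_card_le J
    rw [huniv, Finset.card_univ] at hle
    omega
  obtain ⟨i, -⟩ := hnotMem 0 (by simp; omega)
  obtain ⟨J₁, -, hc₁, hP₁⟩ := h i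
  obtain ⟨j, hj⟩ := hnotMem J₁ (by omega)
  obtain ⟨J₂, hj₂, hc₂, hP₂⟩ := h j
  obtain ⟨k, hk⟩ := hnotMem (J₁ + J₂) (by rw [Multiset.card_add]; omega)
  obtain ⟨J₃, hk₃, hc₃, hP₃⟩ := h k
  rw [Multiset.mem_add, not_or] at hk
  exact ⟨J₁, J₂, J₃, hc₁, hc₂, hc₃, fun e => hj (e ▸ hj₂), fun e => hk.1 (e ▸ hk₃),
    fun e => hk.2 (e ▸ hk₃), hP₁, hP₂, hP₃⟩

/-- If `ψ` is the Lipschitz forcing with derivative the 1-periodic extension of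
the simple function `∑ w_i 1_{X_i}` over a measurable partition of `[0,1)` with
`N > 3q` pieces of positive measure, and `(b, ω)` with `b ∈ (0,1]` is a
`p/q`-pinch point of its family, then there are at least three distinct
multisets `J` of size `q` of indices with `∏_{j∈J} (1 + b w_j) = 1`. -/
theorem stmt10 (q N : ℕ) (hq : 1 ≤ q) (hN : 3 * q < N)
    (X : Fin N → Set ℝ) (hmeas : ∀ i, MeasurableSet (X i))
    (hdisj : Pairwise (Function.onFun Disjoint X))
    (hcover : (⋃ i, X i) = Set.Ico (0 : ℝ) 1)
    (hpos : ∀ i, 0 < volume (X i))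
    (w : Fin N → ℝ) (hw : ∑ i, w i * (volume (X i)).toReal = 0)
    (c : ℝ) (ψ : ℝ → ℝ)
    (hψ : ψ = fun x => c + ∫ t in (0 : ℝ)..x,
      ∑ i, w i * Set.indicator (X i) (fun _ => (1 : ℝ)) (Int.fract t))
    (b : ℝ) (hb : b ∈ Set.Ioc (0 : ℝ) 1) (ω : ℝ) (p : ℤ)
    (hpinch : (fun x => x + ω + b * ψ x)^[q] = fun x => x + (p : ℝ)) :
    ∃ J₁ J₂ J₃ : Multiset (Fin N),
      Multiset.card J₁ = q ∧ Multiset.card J₂ = q ∧ Multiset.card J₃ = q ∧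
      J₁ ≠ J₂ ∧ J₁ ≠ J₃ ∧ J₂ ≠ J₃ ∧
      (J₁.map (fun j => 1 + b * w j)).prod = 1 ∧
      (J₂.map (fun j => 1 + b * w j)).prod = 1 ∧
      (J₃.map (fun j => 1 + b * w j)).prod = 1 := by
  have hX (t : ℝ) : ∃ i, Int.fract t ∈ X i :=
    Set.mem_iUnion.1 (hcover ▸ ⟨Int.fract_nonneg t, Int.fract_lt_one t⟩)
  choose idx hidx using hX
  have hidx_eq {i : Fin N} {t : ℝ} (ht : Int.fract t ∈ X i) : idx t = i := by
    by_contra hne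
    exact Set.disjoint_left.1 (hdisj hne) (hidx t) ht
  let W : ℝ → ℝ := fun t => ∑ i, w i * Set.indicator (X i) (fun _ => (1 : ℝ)) (Int.fract t)
  have hW (t : ℝ) : W t = w (idx t) := by
    refine (Finset.sum_eq_single (idx t) (fun i _ hi => ?_) (by simp)).trans ?_
    · rw [Set.indicator_of_notMem fun ht => hi (hidx_eq ht).symm, mul_zero]
    · rw [Set.indicator_of_mem (hidx t), mul_one]
  have hWmeas : Measurable W := Finset.measurable_fun_sum _ fun i _ =>
    ((measurable_const.indicator (hmeas i)).comp measurable_fract).const_mul (w i)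
  have hWbound (t : ℝ) : ‖W t‖ ≤ (∑ i, ‖w i‖₊ : NNReal) := by
    rw [hW, ← coe_nnnorm, NNReal.coe_le_coe]
    exact Finset.single_le_sum (f := fun i => ‖w i‖₊) (fun _ _ => bot_le) (Finset.mem_univ _)
  have hWint : LocallyIntegrable W :=
    (locallyIntegrable_const ((∑ i, ‖w i‖₊ : NNReal) : ℝ)).mono hWmeas.aestronglyMeasurable
      (Filter.Eventually.of_forall fun t => (hWbound t).trans (le_abs_self _))
  have hψW : ψ = fun x => c + ∫ t in (0 : ℝ)..x, W t := hψ
  have hderiv : ∀ᵐ x, HasDerivAt (fun x => x + ω + b * ψ x) (1 + b * w (idx x)) x := by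
    filter_upwards [LocallyIntegrable.ae_hasDerivAt_integral hWint] with x hx
    rw [hψW, ← hW]
    exact ((hasDerivAt_id x).add_const ω).add (((hx 0).const_add c).const_mul b)
  have hlip : LipschitzWith (1 + ‖b‖₊ * ∑ i, ‖w i‖₊) fun x => x + ω + b * ψ x := by
    have hprim := lipschitzWith_primitive 0 hWint hWbound
    refine LipschitzWith.of_dist_le_mul fun x y => ?_
    have hxy := hprim.dist_le_mul x y
    simp only [hψW, Real.dist_eq] at hxy ⊢
    set F := fun x => ∫ t in (0 : ℝ)..x, W t
    change |F x - F y| ≤ _ at hxy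
    change |x + ω + b * (c + F x) - (y + ω + b * (c + F y))| ≤ _
    calc _ = |(x - y) + b * (F x - F y)| := by congr 1; ring
      _ ≤ |x - y| + |b| * |F x - F y| := by rw [← abs_mul]; exact abs_add_le _ _
      _ ≤ |x - y| + |b| * ((∑ i, ‖w i‖₊ : NNReal) * |x - y|) := by gcongr
      _ = _ := by push_cast; rw [Real.norm_eq_abs]; ring
  have hprod := ae_prod_deriv_orbit_eq_one hlip hderiv hpinch
  refine exists_three_distinct_multisets
    (P := fun J => (J.map fun j => 1 + b * w j).prod = 1) (by rw [Fintype.card_fin]; omega)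
    fun i => ?_
  obtain ⟨x, hxi, hx⟩ : ∃ x ∈ X i, ∏ k ∈ Finset.range q,
      (1 + b * w (idx ((fun x => x + ω + b * ψ x)^[k] x))) = 1 := by
    by_contra! hnone
    exact (hpos i).ne' (measure_mono_null (fun x hx => hnone x hx) (ae_iff.1 hprod))
  refine ⟨(Multiset.range q).map fun k => idx ((fun x => x + ω + b * ψ x)^[k] x), ?_, by simp, ?_⟩
  · have hIco : x ∈ Set.Ico (0 : ℝ) 1 := hcover ▸ Set.mem_iUnion_of_mem i hxi
    refine Multiset.mem_map.2 ⟨0, Multiset.mem_range.2 hq, hidx_eq ?_⟩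
    rwa [Function.iterate_zero_apply, Int.fract_eq_self.2 hIco]
  · rw [Multiset.map_map]
    exact hx
end
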